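/- Let m and k₂ be non-negative integers and g a positive integer. The presented group ⟨x, y, γ, μ ∣ γ^(2^m) x, y, (x y x⁻¹ y⁻¹)^(2^k₂), γ μ⁻ᵍ⟩ is an infinite cyclic group generated by the image of μ. -/

import Mathlib

/-- A group generated by `a` with a homomorphism to `ℤ` sending `a` to `1` is isomorphic to `ℤ`. -/
theorem nonempty_mulEquiv_int_of_zpowers_eq_top {G : Type*} [Group G] {a : G}
    (ha : Subgroup.zpowers a = ⊤) (φ : G →* Multiplicative ℤ)
    (hφ : φ a = Multiplicative.ofAdd 1) : Nonempty (G ≃* Multiplicative ℤ) := by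
  have hpow (n : ℤ) : φ (a ^ n) = Multiplicative.ofAdd n := by
    rw [map_zpow, hφ, ← ofAdd_zsmul, smul_eq_mul, mul_one]
  refine ⟨MulEquiv.ofBijective φ ⟨?_, fun z => ⟨a ^ z.toAdd, hpow _⟩⟩⟩
  refine (injective_iff_map_eq_one φ).2 fun b hb => ?_
  obtain ⟨n, rfl⟩ := Subgroup.mem_zpowers_iff.1 (ha ▸ Subgroup.mem_top b)
  rw [hpow, ofAdd_eq_one] at hb
  rw [hb, zpow_zero]

/-- Lemma 6.3(1), knot group: ⟨x, y, γ, μ ∣ γ^(2^m) x, y, (x y x⁻¹ y⁻¹)^(2^k₂),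
γ μ⁻ᵍ⟩ is infinite cyclic generated by the image of μ.  (x = 0, y = 1, γ = 2, μ = 3.) -/
theorem stmt9 (m k₂ g : ℕ) (hg : 0 < g) :
    ∀ (rels : Set (FreeGroup (Fin 4))),
      rels = {(FreeGroup.of 2) ^ (2 ^ m) * FreeGroup.of 0,
               FreeGroup.of 1,
               (FreeGroup.of 0 * FreeGroup.of 1 * (FreeGroup.of 0)⁻¹ * (FreeGroup.of 1)⁻¹) ^ (2 ^ k₂),
               FreeGroup.of 2 * (FreeGroup.of 3) ^ (-(g : ℤ))} →
      (Nonempty (PresentedGroup rels ≃* Multiplicative ℤ) ∧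
        Subgroup.zpowers (PresentedGroup.of ((3 : Fin 4)) : PresentedGroup rels) = ⊤) := by
  intro rels hrels
  have hone {r : FreeGroup (Fin 4)} (hr : r ∈ rels) : PresentedGroup.mk rels r = 1 :=
    PresentedGroup.one_of_mem hr
  have hγx : (PresentedGroup.of 2 : PresentedGroup rels) ^ 2 ^ m * PresentedGroup.of 0 = 1 :=
    hone (r := FreeGroup.of 2 ^ 2 ^ m * FreeGroup.of 0) (by simp [hrels])
  have hy : (PresentedGroup.of 1 : PresentedGroup rels) = 1 :=
    hone (r := FreeGroup.of 1) (by simp [hrels])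
  have hγμ : (PresentedGroup.of 2 : PresentedGroup rels) *
      PresentedGroup.of 3 ^ (-(g : ℤ)) = 1 :=
    hone (r := FreeGroup.of 2 * FreeGroup.of 3 ^ (-(g : ℤ))) (by simp [hrels])
  have htop : Subgroup.zpowers (PresentedGroup.of (3 : Fin 4) : PresentedGroup rels) = ⊤ := by
    have hμ := Subgroup.mem_zpowers (PresentedGroup.of (3 : Fin 4) : PresentedGroup rels)
    have hγ : (PresentedGroup.of 2 : PresentedGroup rels) ∈
        Subgroup.zpowers (PresentedGroup.of 3) := by
      rw [eq_inv_of_mul_eq_one_left hγμ]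
      exact inv_mem (zpow_mem hμ _)
    rw [eq_top_iff, ← PresentedGroup.closure_range_of, Subgroup.closure_le]
    rintro _ ⟨i, rfl⟩
    fin_cases i
    · change (PresentedGroup.of 0 : PresentedGroup rels) ∈ Subgroup.zpowers (PresentedGroup.of 3)
      rw [eq_inv_of_mul_eq_one_right hγx]
      exact inv_mem (pow_mem hγ _)
    · change (PresentedGroup.of 1 : PresentedGroup rels) ∈ Subgroup.zpowers (PresentedGroup.of 3)
      rw [hy]
      exact one_mem _
    · exact hγ
    · exact hμ
  let μ : Multiplicative ℤ := Multiplicative.ofAdd 1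
  let f : Fin 4 → Multiplicative ℤ := ![((μ ^ g) ^ 2 ^ m)⁻¹, 1, μ ^ g, μ]
  have hf : ∀ r ∈ rels, FreeGroup.lift f r = 1 := by
    rw [hrels]
    rintro r (rfl | rfl | rfl | rfl) <;> simp [f]
  exact ⟨nonempty_mulEquiv_int_of_zpowers_eq_top htop (PresentedGroup.toGroup hf)
    (PresentedGroup.toGroup.of hf), htop⟩
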